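/- arXiv:1708.09664 — 5 statements merged into one kernel-verified Lean document; each statement's English description precedes it below -/
import Mathlib

section
/- Green formula: Let b be a graph over X and q : X → ℝ a potential. For every f ∈ F(X) and every ψ ∈ C_c(X), all sums below converge absolutely and (1/2)∑_{x,y∈X} b(x,y)(f(x) − f(y))(ψ(x) − ψ(y)) + ∑_{x∈X} q(x)f(x)ψ(x) = ∑_{x∈X} (Hf)(x)ψ(x) = ∑_{x∈X} f(x)(Hψ)(x). Moreover, for every φ ∈ C_c(X) the function Hφ is square summable on X. -/
open Filter Topology

variable {X : Type*}

/-- A graph over `X`: symmetric, nonnegative, zero diagonal, locally summable. -/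
def IsGraph (b : X → X → ℝ) : Prop :=
  (∀ x y, 0 ≤ b x y) ∧ (∀ x y, b x y = b y x) ∧ (∀ x, b x x = 0) ∧
    ∀ x, Summable fun y => b x y

/-- Connectedness of the graph `b`: any two vertices are joined by a path of
adjacent vertices. -/
def GraphConnected (b : X → X → ℝ) : Prop :=
  ∀ x y : X, ∃ (n : ℕ) (p : ℕ → X), p 0 = x ∧ p n = y ∧ ∀ i < n, 0 < b (p i) (p (i + 1))

/-- A set `W` is connected in the graph `b` if any two of its points are joined by a
path of adjacent vertices lying in `W`. -/
def ConnectedIn (b : X → X → ℝ) (W : Set X) : Prop :=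
  ∀ x ∈ W, ∀ y ∈ W, ∃ (n : ℕ) (p : ℕ → X), p 0 = x ∧ p n = y ∧
    (∀ i ≤ n, p i ∈ W) ∧ ∀ i < n, 0 < b (p i) (p (i + 1))

/-- Local finiteness of the graph `b`. -/
def LocFin (b : X → X → ℝ) : Prop := ∀ x, {y | 0 < b x y}.Finite

/-- Membership in `F(X)`, the functions against which `b` is summable. -/
def MemF (b : X → X → ℝ) (f : X → ℝ) : Prop :=
  ∀ x, Summable fun y => b x y * |f y|

/-- The formal Schrödinger operator `H = L + q`. -/
noncomputable def Hop (b : X → X → ℝ) (q : X → ℝ) (f : X → ℝ) (x : X) : ℝ :=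
  (∑' y, b x y * (f x - f y)) + q x * f x

/-- Membership in `C_c(X)`: finitely supported functions. -/
def FinSupp (φ : X → ℝ) : Prop := (Function.support φ).Finite

/-- The energy form `h` associated with `b` and `q`, evaluated on `C_c(X)`. -/
noncomputable def hform (b : X → X → ℝ) (q : X → ℝ) (φ : X → ℝ) : ℝ :=
  (1 / 2) * (∑' p : X × X, b p.1 p.2 * (φ p.1 - φ p.2) ^ 2) + ∑' x, q x * φ x ^ 2

/-- The form `h` is subcritical in `X`. -/
def Subcritical (b : X → X → ℝ) (q : X → ℝ) : Prop :=
  ∃ w : X → ℝ, (∀ x, 0 ≤ w x) ∧ w ≠ 0 ∧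
    ∀ φ : X → ℝ, FinSupp φ → (∑' x, w x * φ x ^ 2) ≤ hform b q φ

/-- The capacity of the singleton `{x}` with respect to the form `h`. -/
noncomputable def capH (b : X → X → ℝ) (q : X → ℝ) (x : X) : ℝ :=
  sInf {r : ℝ | ∃ φ : X → ℝ, FinSupp φ ∧ φ x = 1 ∧ r = hform b q φ}

/-- The extended (extended-real-valued) energy of the weighted Laplacian part. -/
noncomputable def hExt (b : X → X → ℝ) (f : X → ℝ) : ENNReal :=
  (∑' p : X × X, ENNReal.ofReal (b p.1 p.2 * (f p.1 - f p.2) ^ 2)) / 2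

theorem HasSum.of_forall_eq {ι : Type*} {u v : ι → ℝ} {a : ℝ} (hv : HasSum v a)
    (h : ∀ i, u i = v i) : HasSum u a :=
  (funext h : u = v) ▸ hv

theorem summable_prod_of_finite_rows {g : X × X → ℝ} {S : Set X} (hS : S.Finite)
    (hrow : ∀ x, Summable fun y => g (x, y)) (hzero : ∀ x, x ∉ S → ∀ y, g (x, y) = 0) :
    Summable g := by
  rw [← summable_abs_iff, summable_prod_of_nonneg fun p => abs_nonneg (g p)]
  refine ⟨fun x => (hrow x).abs, summable_of_hasFiniteSupport (hS.subset fun x hx => ?_)⟩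
  by_contra hxS
  exact hx (by simp [hzero x hxS])

theorem Summable.sq_of_real {u : X → ℝ} (hu : Summable u) : Summable fun x => u x ^ 2 := by
  refine Summable.of_norm_bounded_eventually hu.abs ?_
  have h : ∀ᶠ x in cofinite, |u x| < 1 := by
    simpa using hu.tendsto_cofinite_zero.abs.eventually (gt_mem_nhds (by simp))
  filter_upwards [h] with x hx
  rw [Real.norm_eq_abs, abs_pow]
  nlinarith [abs_nonneg (u x)]

section Green

variable {b : X → X → ℝ} {f ψ : X → ℝ}

theorem MemF.summable_mul (hb : IsGraph b) (hf : MemF b f) (x : X) :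
    Summable fun y => b x y * f y := by
  rw [← summable_abs_iff]
  simpa [abs_mul, abs_of_nonneg (hb.1 _ _)] using hf x

theorem memF_one (hb : IsGraph b) : MemF b fun _ => 1 := fun x => by
  simpa using hb.2.2.2 x

theorem FinSupp.summable_mul (hψ : FinSupp ψ) (g : X → ℝ) : Summable fun x => g x * ψ x :=
  summable_of_hasFiniteSupport (hψ.subset fun x hx hx' => hx (by simp [hx']))

theorem summable_diagonal_part (hb : IsGraph b) (f : X → ℝ) (hψ : FinSupp ψ) :
    Summable fun p : X × X => b p.1 p.2 * f p.1 * ψ p.1 := by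
  refine summable_prod_of_finite_rows hψ (fun x => ?_) fun x hx y => ?_
  · exact ((hb.2.2.2 x).mul_right (f x)).mul_right (ψ x)
  · simp [Function.notMem_support.mp hx]

theorem summable_offDiagonal_part (hb : IsGraph b) (hf : MemF b f) (hψ : FinSupp ψ) :
    Summable fun p : X × X => b p.1 p.2 * f p.2 * ψ p.1 := by
  refine summable_prod_of_finite_rows hψ (fun x => ?_) fun x hx y => ?_
  · exact (hf.summable_mul hb x).mul_right (ψ x)
  · simp [Function.notMem_support.mp hx]

theorem hasSum_laplacian_mul (hb : IsGraph b) (hf : MemF b f) (hψ : FinSupp ψ) :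
    HasSum (fun p : X × X => b p.1 p.2 * (f p.1 - f p.2) * ψ p.1)
      ((∑' p : X × X, b p.1 p.2 * f p.1 * ψ p.1) - ∑' p : X × X, b p.1 p.2 * f p.2 * ψ p.1) := by
  refine HasSum.of_forall_eq ((summable_diagonal_part hb f hψ).hasSum.sub
    (summable_offDiagonal_part hb hf hψ).hasSum) fun p => ?_
  ring

theorem hasSum_mul_laplacian (hb : IsGraph b) (hf : MemF b f) (hψ : FinSupp ψ) :
    HasSum (fun p : X × X => f p.1 * (b p.1 p.2 * (ψ p.1 - ψ p.2)))
      ((∑' p : X × X, b p.1 p.2 * f p.1 * ψ p.1) - ∑' p : X × X, b p.1 p.2 * f p.2 * ψ p.1) := by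
  have hswap := (Equiv.prodComm X X).hasSum_iff.mpr
    (summable_offDiagonal_part hb hf hψ).hasSum
  refine HasSum.of_forall_eq ((summable_diagonal_part hb f hψ).hasSum.sub hswap) fun p => ?_
  simp only [Function.comp_apply, Equiv.prodComm_apply, Prod.fst_swap, Prod.snd_swap,
    hb.2.1 p.2 p.1]
  ring

theorem hasSum_energy (hb : IsGraph b) (hf : MemF b f) (hψ : FinSupp ψ) :
    HasSum (fun p : X × X => b p.1 p.2 * (f p.1 - f p.2) * (ψ p.1 - ψ p.2))
      (2 * ((∑' p : X × X, b p.1 p.2 * f p.1 * ψ p.1) -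
        ∑' p : X × X, b p.1 p.2 * f p.2 * ψ p.1)) := by
  have h := hasSum_laplacian_mul hb hf hψ
  have hswap := (Equiv.prodComm X X).hasSum_iff.mpr h
  rw [two_mul]
  refine HasSum.of_forall_eq (h.add hswap) fun p => ?_
  simp only [Function.comp_apply, Equiv.prodComm_apply, Prod.fst_swap, Prod.snd_swap,
    hb.2.1 p.2 p.1]
  ring

theorem hasSum_Hop_mul (hb : IsGraph b) (q : X → ℝ) (hf : MemF b f) (hψ : FinSupp ψ) :
    HasSum (fun x => Hop b q f x * ψ x)
      ((∑' p : X × X, b p.1 p.2 * f p.1 * ψ p.1) - (∑' p : X × X, b p.1 p.2 * f p.2 * ψ p.1) +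
        ∑' x, q x * f x * ψ x) := by
  have h := hasSum_laplacian_mul hb hf hψ
  have hsum := h.prod_fiberwise fun x => (h.summable.prod_factor x).hasSum
  refine HasSum.of_forall_eq (hsum.add (hψ.summable_mul fun x => q x * f x).hasSum) fun x => ?_
  simp only [Hop, tsum_mul_right, add_mul]

theorem hasSum_mul_Hop (hb : IsGraph b) (q : X → ℝ) (hf : MemF b f) (hψ : FinSupp ψ) :
    HasSum (fun x => f x * Hop b q ψ x)
      ((∑' p : X × X, b p.1 p.2 * f p.1 * ψ p.1) - (∑' p : X × X, b p.1 p.2 * f p.2 * ψ p.1) +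
        ∑' x, q x * f x * ψ x) := by
  have h := hasSum_mul_laplacian hb hf hψ
  have hsum := h.prod_fiberwise fun x => (h.summable.prod_factor x).hasSum
  refine HasSum.of_forall_eq (hsum.add (hψ.summable_mul fun x => q x * f x).hasSum) fun x => ?_
  simp only [Hop, tsum_mul_left]
  ring

end Green

/-- Green formula. -/
theorem green_formula (b : X → X → ℝ) (q : X → ℝ) (hb : IsGraph b)
    (f : X → ℝ) (hf : MemF b f) (ψ : X → ℝ) (hψ : FinSupp ψ) :
    Summable (fun p : X × X => b p.1 p.2 * (f p.1 - f p.2) * (ψ p.1 - ψ p.2)) ∧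
    Summable (fun x => q x * f x * ψ x) ∧
    Summable (fun x => Hop b q f x * ψ x) ∧
    Summable (fun x => f x * Hop b q ψ x) ∧
    (1 / 2) * (∑' p : X × X, b p.1 p.2 * (f p.1 - f p.2) * (ψ p.1 - ψ p.2)) +
        (∑' x, q x * f x * ψ x) = (∑' x, Hop b q f x * ψ x) ∧
    (∑' x, Hop b q f x * ψ x) = (∑' x, f x * Hop b q ψ x) ∧
    ∀ φ : X → ℝ, FinSupp φ → Summable (fun x => Hop b q φ x ^ 2) := by
  have hE := hasSum_energy hb hf hψ
  have hL := hasSum_Hop_mul hb q hf hψ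
  have hR := hasSum_mul_Hop hb q hf hψ
  refine ⟨hE.summable, hψ.summable_mul fun x => q x * f x, hL.summable, hR.summable, ?_, ?_,
    fun φ hφ => ?_⟩
  · rw [hE.tsum_eq, hL.tsum_eq]
    ring
  · rw [hL.tsum_eq, hR.tsum_eq]
  · simpa using (hasSum_mul_Hop hb q (memF_one hb) hφ).summable.sq_of_real
end

section
/- Local Harnack inequality: Let b be a graph over X, q : X → ℝ a potential, W ⊆ X a finite set that is connected (any two points of W are joined by a path of adjacent vertices lying in W), and f : X → ℝ. Then there exists a constant C > 0, depending only on b, q, W and f, such that every function u ∈ F(X) with u ≥ 0 on X and (H − f)u ≥ 0 on W satisfies max_W u ≤ C · min_W u. Moreover, the constant can be chosen monotone in f: for f ≤ f̃ one may take C(H,W,f̃) ≤ C(H,W,f). -/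
open Filter Topology

variable {X : Type*}

/-- If `a i ≤ c i * a (i + 1)` along a chain, the coefficients multiply. -/
theorem le_prod_mul_of_le_mul_succ {a c : ℕ → ℝ} {n : ℕ} (hc : ∀ i < n, 0 ≤ c i)
    (h : ∀ i < n, a i ≤ c i * a (i + 1)) : a 0 ≤ (∏ i ∈ Finset.range n, c i) * a n := by
  induction n with
  | zero => simp
  | succ n ih =>
    calc a 0 ≤ (∏ i ∈ Finset.range n, c i) * a n :=
          ih (fun i hi => hc i (by omega)) (fun i hi => h i (by omega))
      _ ≤ (∏ i ∈ Finset.range n, c i) * (c n * a (n + 1)) :=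
          mul_le_mul_of_nonneg_left (h n (by omega))
            (Finset.prod_nonneg fun i hi => hc i (by have := Finset.mem_range.mp hi; omega))
      _ = (∏ i ∈ Finset.range (n + 1), c i) * a (n + 1) := by
          rw [Finset.prod_range_succ]; ring

/-- The positive part of `deg + q - f`, the diagonal coefficient of `H - f`. -/
noncomputable def diagPart (b : X → X → ℝ) (q f : X → ℝ) (x : X) : ℝ :=
  max 0 ((∑' y, b x y) + q x - f x)

theorem diagPart_nonneg (b : X → X → ℝ) (q f : X → ℝ) (x : X) : 0 ≤ diagPart b q f x :=
  le_max_left _ _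

theorem diagPart_anti (b : X → X → ℝ) (q : X → ℝ) {f g : X → ℝ} {x : X} (h : f x ≤ g x) :
    diagPart b q g x ≤ diagPart b q f x :=
  max_le_max le_rfl (by linarith)

theorem Hop_eq {b : X → X → ℝ} {q u : X → ℝ} {x : X} (hb : Summable fun y => b x y)
    (hu : Summable fun y => b x y * u y) :
    Hop b q u x = ((∑' y, b x y) + q x) * u x - ∑' y, b x y * u y := by
  simp only [Hop, mul_sub]
  rw [(hb.mul_right (u x)).tsum_sub hu, tsum_mul_right]
  ring

/-- A nonnegative supersolution at `x` controls its values at the neighbors of `x`. -/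
theorem le_diagPart_div_mul {b : X → X → ℝ} {q f u : X → ℝ} (hb : IsGraph b) (hu : MemF b u)
    (hu0 : ∀ x, 0 ≤ u x) {x y : X} (hx : f x * u x ≤ Hop b q u x) (hxy : 0 < b x y) :
    u y ≤ diagPart b q f x / b x y * u x := by
  have hs : Summable fun z => b x z * u z := by
    simpa only [abs_of_nonneg (hu0 _)] using hu x
  have hle : b x y * u y ≤ ∑' z, b x z * u z :=
    hs.le_tsum y fun z _ => mul_nonneg (hb.1 x z) (hu0 z)
  rw [Hop_eq (hb.2.2.2 x) hs] at hx
  have hD : ((∑' z, b x z) + q x - f x) * u x ≤ diagPart b q f x * u x :=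
    mul_le_mul_of_nonneg_right (le_max_right _ _) (hu0 x)
  rw [div_mul_eq_mul_div, le_div_iff₀ hxy]
  linarith

/-- Local Harnack inequality, with a constant that can be chosen monotone in `f`. -/
theorem local_harnack (b : X → X → ℝ) (q : X → ℝ) (hb : IsGraph b)
    (W : Set X) (hWfin : W.Finite) (hWconn : ConnectedIn b W) :
    ∃ C : (X → ℝ) → ℝ, (∀ f : X → ℝ, 0 < C f) ∧
      (∀ f : X → ℝ, ∀ u : X → ℝ, MemF b u → (∀ x, 0 ≤ u x) →
        (∀ x ∈ W, f x * u x ≤ Hop b q u x) →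
        ∀ x ∈ W, ∀ y ∈ W, u x ≤ C f * u y) ∧
      ∀ f f' : X → ℝ, (∀ x, f x ≤ f' x) → C f' ≤ C f := by
  have : Fintype W := hWfin.fintype
  have hpath : ∀ r : W × W, ∃ (n : ℕ) (p : ℕ → X), p 0 = r.1 ∧ p n = r.2 ∧
      (∀ i ≤ n, p i ∈ W) ∧ ∀ i < n, 0 < b (p i) (p (i + 1)) :=
    fun r => hWconn r.1 r.1.2 r.2 r.2.2
  choose n p hp0 hpn hpW hpb using hpath
  let c (f : X → ℝ) (r : W × W) (i : ℕ) : ℝ :=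
    diagPart b q f (p r (i + 1)) / b (p r (i + 1)) (p r i)
  have hc (f : X → ℝ) (r : W × W) (i : ℕ) : 0 ≤ c f r i :=
    div_nonneg (diagPart_nonneg b q f _) (hb.1 _ _)
  have hprod (f : X → ℝ) (r : W × W) : 0 ≤ ∏ i ∈ Finset.range (n r), c f r i :=
    Finset.prod_nonneg fun i _ => hc f r i
  refine ⟨fun f => 1 + ∑ r, ∏ i ∈ Finset.range (n r), c f r i, fun f => ?_, ?_, ?_⟩
  · have := Finset.sum_nonneg fun r (_ : r ∈ Finset.univ) => hprod f r
    linarith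
  · intro f u hu hu0 hH x hx y hy
    let r : W × W := (⟨x, hx⟩, ⟨y, hy⟩)
    have hchain : u (p r 0) ≤ (∏ i ∈ Finset.range (n r), c f r i) * u (p r (n r)) :=
      le_prod_mul_of_le_mul_succ (a := fun i => u (p r i)) (fun i _ => hc f r i) fun i hi =>
        le_diagPart_div_mul hb hu hu0 (hH _ (hpW r (i + 1) hi))
          (by rw [hb.2.1]; exact hpb r i hi)
    rw [hp0, hpn] at hchain
    refine hchain.trans (mul_le_mul_of_nonneg_right ?_ (hu0 y))
    have := Finset.single_le_sum (f := fun s => ∏ i ∈ Finset.range (n s), c f s i)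
      (fun s _ => hprod f s) (Finset.mem_univ r)
    linarith
  · intro f f' hff'
    refine add_le_add le_rfl (Finset.sum_le_sum fun r _ =>
      Finset.prod_le_prod (fun i _ => hc f' r i) fun i _ => ?_)
    exact div_le_div_of_nonneg_right (diagPart_anti b q (hff' _)) (hb.1 _ _)
end

section
/- Ground state transform: Let b be a graph over X, q : X → ℝ a potential, v ∈ F(X) strictly positive, and f : X → ℝ with Hv = f·v on X. Then for all φ, ψ ∈ C_c(X), all sums converge absolutely and h(φ,ψ) = h_v(φ/v, ψ/v) + ∑_{x∈X} f(x)φ(x)ψ(x), where h(φ,ψ) = (1/2)∑_{x,y∈X} b(x,y)(φ(x) − φ(y))(ψ(x) − ψ(y)) + ∑_{x∈X} q(x)φ(x)ψ(x). In particular, h(φ) ≥ ∑_{x∈X} f(x)φ(x)² for all φ ∈ C_c(X). -/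
open Filter Topology

variable {X : Type*}

/-- A function on `X × X` with summable rows, all but finitely many of which vanish, is summable,
and its sum is the sum of its row sums. -/
lemma hasSum_prod_of_finite_rows {F : X → X → ℝ} {a : X → ℝ} {S : Finset X}
    (hF : ∀ x ∈ S, HasSum (F x) (a x)) (hS : ∀ x ∉ S, ∀ y, F x y = 0) :
    HasSum (fun p : X × X => F p.1 p.2) (∑ x ∈ S, a x) := by
  classical
  have hrow : ∀ x ∈ S, HasSum (fun p : X × X => if p.1 = x then F p.1 p.2 else 0) (a x) := by
    intro x hx
    refine ((Prod.mk_right_injective x).hasSum_iff ?_).mp ?_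
    · rintro ⟨y, z⟩ hyz
      refine if_neg ?_
      rintro rfl
      exact hyz ⟨z, rfl⟩
    · simpa [Function.comp_def] using hF x hx
  refine (hasSum_sum hrow).congr_fun ?_
  rintro ⟨x, y⟩
  by_cases hx : x ∈ S
  · simp [hx]
  · simp [hS x hx y]

lemma FinSupp.eq_zero_of_notMem {φ : X → ℝ} (hφ : FinSupp φ) {x : X}
    (hx : x ∉ hφ.toFinset) : φ x = 0 :=
  Function.notMem_support.mp fun h => hx ((Set.Finite.mem_toFinset hφ).mpr h)

/-- A finitely supported function stays finitely supported after multiplication. -/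
lemma FinSupp.summable_mul_mul {φ : X → ℝ} (hφ : FinSupp φ) (c ψ : X → ℝ) :
    Summable fun x => c x * φ x * ψ x :=
  summable_of_hasFiniteSupport <| hφ.subset fun x hx h => hx (by simp [h])

/-- The energy form converges on finitely supported functions. -/
lemma IsGraph.summable_energy {b : X → X → ℝ} (hb : IsGraph b) {φ ψ : X → ℝ}
    (hφ : FinSupp φ) (hψ : FinSupp ψ) :
    Summable fun p : X × X => b p.1 p.2 * (φ p.1 - φ p.2) * (ψ p.1 - ψ p.2) := by
  have hrow : ∀ x, Summable fun y => b x y * φ x * (ψ x - ψ y) := by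
    intro x
    have h := ((hb.2.2.2 x).mul_right (φ x * ψ x)).sub
      (hψ.summable_mul_mul (fun y => b x y) fun _ => φ x)
    exact h.congr fun y => by ring
  have hA := (hasSum_prod_of_finite_rows (S := hφ.toFinset)
    (fun x _ => (hrow x).hasSum) (fun x hx y => by simp [hφ.eq_zero_of_notMem hx])).summable
  refine (hA.add hA.prod_symm).congr ?_
  rintro ⟨x, y⟩
  simp only [Prod.fst_swap, Prod.snd_swap, hb.2.1 y x]
  ring

/-- The pairing of `(Lv / v) φ` with `ψ`, where `L` is the weighted Laplacian, as a double sum. -/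
lemma hasSum_laplacian_pairing {b : X → X → ℝ} {q : X → ℝ} (hb : IsGraph b)
    {v : X → ℝ} (hv : MemF b v) (hvpos : ∀ x, 0 < v x)
    {f : X → ℝ} (hveq : ∀ x, Hop b q v x = f x * v x) {φ : X → ℝ} (hφ : FinSupp φ) (ψ : X → ℝ) :
    HasSum (fun p : X × X => b p.1 p.2 * (v p.1 - v p.2) * (φ p.1 * ψ p.1 / v p.1))
      ((∑' x, f x * φ x * ψ x) - ∑' x, q x * φ x * ψ x) := by
  have hrow : ∀ x, HasSum (fun y => b x y * (v x - v y) * (φ x * ψ x / v x))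
      (f x * φ x * ψ x - q x * φ x * ψ x) := by
    intro x
    have hs : Summable fun y => b x y * (v x - v y) :=
      (((hb.2.2.2 x).mul_right (v x)).sub (hv x)).congr fun y => by
        rw [abs_of_pos (hvpos y)]; ring
    have hsum : ∑' y, b x y * (v x - v y) = f x * v x - q x * v x :=
      eq_sub_of_add_eq (hveq x)
    have h := hs.hasSum.mul_right (φ x * ψ x / v x)
    have hx := (hvpos x).ne'
    have hval : (f x * v x - q x * v x) * (φ x * ψ x / v x) =
        f x * φ x * ψ x - q x * φ x * ψ x := by
      field_simp
    rwa [hsum, hval] at h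
  have h := hasSum_prod_of_finite_rows (S := hφ.toFinset) (fun x _ => hrow x)
    (fun x hx y => by simp [hφ.eq_zero_of_notMem hx])
  rwa [← (hφ.summable_mul_mul f ψ).tsum_sub (hφ.summable_mul_mul q ψ),
    tsum_eq_sum (s := hφ.toFinset) fun x hx => by simp [hφ.eq_zero_of_notMem hx]]

/-- The ground state transform: convergence of all sums and the identity of bilinear forms. -/
lemma ground_state_transform_bilinear (b : X → X → ℝ) (q : X → ℝ) (hb : IsGraph b)
    (v : X → ℝ) (hv : MemF b v) (hvpos : ∀ x, 0 < v x)
    (f : X → ℝ) (hveq : ∀ x, Hop b q v x = f x * v x)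
    (φ ψ : X → ℝ) (hφ : FinSupp φ) (hψ : FinSupp ψ) :
    Summable (fun p : X × X => b p.1 p.2 * (φ p.1 - φ p.2) * (ψ p.1 - ψ p.2)) ∧
    Summable (fun x => q x * φ x * ψ x) ∧
    Summable (fun p : X × X => b p.1 p.2 * v p.1 * v p.2 *
      (φ p.1 / v p.1 - φ p.2 / v p.2) * (ψ p.1 / v p.1 - ψ p.2 / v p.2)) ∧
    Summable (fun x => f x * φ x * ψ x) ∧
    (1 / 2) * (∑' p : X × X, b p.1 p.2 * (φ p.1 - φ p.2) * (ψ p.1 - ψ p.2)) +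
        (∑' x, q x * φ x * ψ x) =
      (1 / 2) * (∑' p : X × X, b p.1 p.2 * v p.1 * v p.2 *
          (φ p.1 / v p.1 - φ p.2 / v p.2) * (ψ p.1 / v p.1 - ψ p.2 / v p.2)) +
        (∑' x, f x * φ x * ψ x) := by
  have hE := hb.summable_energy hφ hψ
  have hG := hasSum_laplacian_pairing hb hv hvpos hveq hφ ψ
  have hEv := hE.hasSum.sub (hG.add ((Equiv.prodComm X X).hasSum_iff.mpr hG))
  have hcongr := hEv.congr_fun (g := fun p : X × X => b p.1 p.2 * v p.1 * v p.2 *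
      (φ p.1 / v p.1 - φ p.2 / v p.2) * (ψ p.1 / v p.1 - ψ p.2 / v p.2)) <| by
    rintro ⟨x, y⟩
    have hx := (hvpos x).ne'
    have hy := (hvpos y).ne'
    simp only [Function.comp_apply, Equiv.prodComm_apply, Prod.swap_prod_mk, hb.2.1 y x]
    field_simp
    ring
  exact ⟨hE, hφ.summable_mul_mul q ψ, hcongr.summable, hφ.summable_mul_mul f ψ,
    by rw [hcongr.tsum_eq]; ring⟩

/-- Ground state transform. -/
theorem ground_state_transform (b : X → X → ℝ) (q : X → ℝ) (hb : IsGraph b)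
    (v : X → ℝ) (hv : MemF b v) (hvpos : ∀ x, 0 < v x)
    (f : X → ℝ) (hveq : ∀ x, Hop b q v x = f x * v x)
    (φ ψ : X → ℝ) (hφ : FinSupp φ) (hψ : FinSupp ψ) :
    Summable (fun p : X × X => b p.1 p.2 * (φ p.1 - φ p.2) * (ψ p.1 - ψ p.2)) ∧
    Summable (fun x => q x * φ x * ψ x) ∧
    Summable (fun p : X × X => b p.1 p.2 * v p.1 * v p.2 *
      (φ p.1 / v p.1 - φ p.2 / v p.2) * (ψ p.1 / v p.1 - ψ p.2 / v p.2)) ∧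
    Summable (fun x => f x * φ x * ψ x) ∧
    (1 / 2) * (∑' p : X × X, b p.1 p.2 * (φ p.1 - φ p.2) * (ψ p.1 - ψ p.2)) +
        (∑' x, q x * φ x * ψ x) =
      (1 / 2) * (∑' p : X × X, b p.1 p.2 * v p.1 * v p.2 *
          (φ p.1 / v p.1 - φ p.2 / v p.2) * (ψ p.1 / v p.1 - ψ p.2 / v p.2)) +
        (∑' x, f x * φ x * ψ x) ∧
    (∑' x, f x * φ x ^ 2) ≤ hform b q φ := by
  obtain ⟨h₁, h₂, h₃, h₄, h₅⟩ :=
    ground_state_transform_bilinear b q hb v hv hvpos f hveq φ ψ hφ hψ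
  refine ⟨h₁, h₂, h₃, h₄, h₅, ?_⟩
  obtain ⟨-, -, -, -, h⟩ := ground_state_transform_bilinear b q hb v hv hvpos f hveq φ φ hφ hφ
  have hnn : 0 ≤ ∑' p : X × X, b p.1 p.2 * v p.1 * v p.2 *
      (φ p.1 / v p.1 - φ p.2 / v p.2) * (φ p.1 / v p.1 - φ p.2 / v p.2) := by
    refine tsum_nonneg fun p => ?_
    rw [mul_assoc]
    exact mul_nonneg (mul_nonneg (mul_nonneg (hb.1 _ _) (hvpos _).le) (hvpos _).le)
      (mul_self_nonneg _)
  simp only [hform, pow_two, ← mul_assoc] at h ⊢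
  linarith
end

section
/- Allegretto–Piepenbrink theorem, measure-free version: Let b be a connected graph over X and q : X → ℝ a potential such that h ≥ 0. Then the set {λ ∈ ℝ : there exists a positive u ∈ F(X) with Hu ≥ λ·u on X} has a maximum, and this maximum equals inf{ h(φ) : φ ∈ C_c(X), ∑_{x∈X} φ(x)² = 1 }. -/
open Filter Topology

variable {X : Type*}

section AllegrettoPiepenbrink

theorem GraphConnected.induction {X : Type*} {b : X → X → ℝ} (hconn : GraphConnected b)
    {P : X → Prop} (hstep : ∀ x y, 0 < b x y → P x → P y) {x : X} (hx : P x) (y : X) : P y := by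
  obtain ⟨n, p, h0, hn, hp⟩ := hconn x y
  have key : ∀ i ≤ n, P (p i) := by
    intro i
    induction i with
    | zero => intro _; rwa [h0]
    | succ k ih => intro hk; exact hstep _ _ (hp k hk) (ih (by omega))
  exact hn ▸ key n le_rfl

/-- On finitely supported functions, the energy form is a finite quadratic expression. -/
theorem hform_eq_finset_sum {X : Type*} {b : X → X → ℝ} (q : X → ℝ) (hb : IsGraph b)
    (K : Finset X) (φ : X → ℝ) (hφ : ∀ x ∉ K, φ x = 0) :
    hform b q φ = ∑ x ∈ K, ((∑' y, b x y) + q x) * φ x ^ 2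
      - ∑ x ∈ K, ∑ y ∈ K, b x y * (φ x * φ y) := by
  obtain ⟨hnn, hsym, -, hsum⟩ := hb
  have hA : HasSum (fun p : X × X => b p.1 p.2 * φ p.1 ^ 2)
      (∑ x ∈ K, (∑' y, b x y) * φ x ^ 2) := by
    have hx : ∀ x, Summable fun y => b x y * φ x ^ 2 := fun x => (hsum x).mul_right (φ x ^ 2)
    have hs : Summable (fun p : X × X => b p.1 p.2 * φ p.1 ^ 2) := by
      refine (summable_prod_of_nonneg
        (fun p => mul_nonneg (hnn p.1 p.2) (sq_nonneg (φ p.1)))).2 ⟨hx, ?_⟩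
      refine summable_of_ne_finset_zero (s := K) fun x hx => ?_
      simp [hφ x hx]
    have ht : ∑' p : X × X, b p.1 p.2 * φ p.1 ^ 2 = ∑ x ∈ K, (∑' y, b x y) * φ x ^ 2 := by
      rw [hs.tsum_prod' hx,
        tsum_eq_sum (s := K) fun x hx => by simp [hφ x hx]]
      exact Finset.sum_congr rfl fun x _ => (hsum x).tsum_mul_right (φ x ^ 2)
    exact ht ▸ hs.hasSum
  have hB : HasSum (fun p : X × X => b p.1 p.2 * φ p.2 ^ 2)
      (∑ x ∈ K, (∑' y, b x y) * φ x ^ 2) := by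
    refine (Equiv.hasSum_iff (Equiv.prodComm X X)).1 (hA.congr_fun ?_)
    intro p
    simp [hsym p.2 p.1]
  have hC : HasSum (fun p : X × X => b p.1 p.2 * (φ p.1 * φ p.2))
      (∑ x ∈ K, ∑ y ∈ K, b x y * (φ x * φ y)) := by
    rw [← Finset.sum_product']
    refine hasSum_sum_of_ne_finset_zero fun p hp => ?_
    rw [Finset.mem_product, not_and_or] at hp
    rcases hp with hp | hp <;> simp [hφ _ hp]
  have hD : ∑' p : X × X, b p.1 p.2 * (φ p.1 - φ p.2) ^ 2 =
      ∑ x ∈ K, (∑' y, b x y) * φ x ^ 2 + ∑ x ∈ K, (∑' y, b x y) * φ x ^ 2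
        - 2 * ∑ x ∈ K, ∑ y ∈ K, b x y * (φ x * φ y) := by
    rw [← ((hA.add hB).sub (hC.mul_left 2)).tsum_eq]
    exact tsum_congr fun p => by ring
  rw [hform, hD, tsum_eq_sum (s := K) fun x hx => by simp [hφ x hx]]
  simp only [add_mul, Finset.sum_add_distrib]
  ring

theorem hop_eq_sub_tsum {X : Type*} {b : X → X → ℝ} (q : X → ℝ) {u : X → ℝ} {x : X}
    (hb : Summable fun y => b x y) (hu : Summable fun y => b x y * u y) :
    Hop b q u x = ((∑' y, b x y) + q x) * u x - ∑' y, b x y * u y := by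
  simp only [Hop, mul_sub]
  rw [(hb.mul_right (u x)).tsum_sub hu, tsum_mul_right]
  ring

theorem mul_sum_sq_le_hform_of_supersolution {X : Type*} {b : X → X → ℝ} {q : X → ℝ}
    (hb : IsGraph b) (hconn : GraphConnected b) {lam : ℝ} {u : X → ℝ} (huF : MemF b u)
    (hu0 : ∀ x, 0 ≤ u x) (hune : u ≠ 0) (hu : ∀ x, lam * u x ≤ Hop b q u x)
    (K : Finset X) (φ : X → ℝ) (hφ : ∀ x ∉ K, φ x = 0) :
    lam * ∑ x ∈ K, φ x ^ 2 ≤ hform b q φ := by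
  have hus : ∀ x, Summable fun y => b x y * u y := fun x => by
    simpa only [abs_of_nonneg (hu0 _)] using huF x
  have hineq : ∀ x, lam * u x ≤ ((∑' y, b x y) + q x) * u x - ∑' y, b x y * u y := fun x => by
    rw [← hop_eq_sub_tsum q (hb.2.2.2 x) (hus x)]
    exact hu x
  have hterm : ∀ x y, 0 ≤ b x y * u y := fun x y => mul_nonneg (hb.1 x y) (hu0 y)
  have hup : ∀ x, 0 < u x := by
    by_contra! hcon
    obtain ⟨x, hx⟩ := hcon
    refine hune (funext fun y => hconn.induction (P := fun z => u z = 0) ?_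
      (le_antisymm hx (hu0 x)) y)
    intro z w hzw hz
    have h1 := hineq z
    rw [hz] at h1
    have h2 := (hus z).le_tsum w fun y _ => hterm z y
    have h3 : b z w * u w = 0 := le_antisymm (by linarith) (hterm z w)
    exact (mul_eq_zero.1 h3).resolve_left hzw.ne'
  have hdiag : ∀ x, lam + ∑ y ∈ K, b x y * (u y / u x) ≤ (∑' y, b x y) + q x := by
    intro x
    have h1 := hineq x
    have h2 := (hus x).sum_le_tsum K fun y _ => hterm x y
    have h3 : ∑ y ∈ K, b x y * (u y / u x) = (∑ y ∈ K, b x y * u y) / u x := by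
      rw [Finset.sum_div]
      exact Finset.sum_congr rfl fun y _ => by ring
    rw [h3, ← le_sub_iff_add_le', div_le_iff₀ (hup x)]
    linarith
  rw [hform_eq_finset_sum q hb K φ hφ]
  have h1 : lam * ∑ x ∈ K, φ x ^ 2 + ∑ x ∈ K, ∑ y ∈ K, b x y * (u y / u x * φ x ^ 2) ≤
      ∑ x ∈ K, ((∑' y, b x y) + q x) * φ x ^ 2 := by
    rw [Finset.mul_sum, ← Finset.sum_add_distrib]
    refine Finset.sum_le_sum fun x _ => ?_
    have h2 := mul_le_mul_of_nonneg_right (hdiag x) (sq_nonneg (φ x))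
    rw [add_mul, Finset.sum_mul] at h2
    simpa only [mul_assoc] using h2
  have h2 : ∑ x ∈ K, ∑ y ∈ K, b x y * (u y / u x * φ x ^ 2) =
      ∑ x ∈ K, ∑ y ∈ K, b x y * (u x / u y * φ y ^ 2) := by
    rw [Finset.sum_comm]
    exact Finset.sum_congr rfl fun x _ => Finset.sum_congr rfl fun y _ => by rw [hb.2.1]
  have h3 : 2 * ∑ x ∈ K, ∑ y ∈ K, b x y * (φ x * φ y) ≤
      ∑ x ∈ K, ∑ y ∈ K, b x y * (u y / u x * φ x ^ 2) +
        ∑ x ∈ K, ∑ y ∈ K, b x y * (u x / u y * φ y ^ 2) := by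
    simp only [Finset.mul_sum, ← Finset.sum_add_distrib]
    refine Finset.sum_le_sum fun x _ => Finset.sum_le_sum fun y _ => ?_
    have hx := hup x
    have hy := hup y
    have h4 : u y / u x * φ x ^ 2 + u x / u y * φ y ^ 2 - 2 * (φ x * φ y) =
        (u y * φ x - u x * φ y) ^ 2 / (u x * u y) := by
      field_simp
      ring
    have h5 : 0 ≤ u y / u x * φ x ^ 2 + u x / u y * φ y ^ 2 - 2 * (φ x * φ y) := by
      rw [h4]; positivity
    nlinarith [mul_nonneg (hb.1 x y) h5]
  linarith

/-- A positive definite Schrödinger matrix on a finite set has a nonnegative supersolution. -/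
theorem exists_nonneg_supersolution_of_posDef {ι : Type*} [Fintype ι] {c : ι → ι → ℝ}
    {D : ι → ℝ} (hc : ∀ x y, 0 ≤ c x y)
    (hpd : ∀ φ : ι → ℝ, φ ≠ 0 → 0 < ∑ x, φ x * (D x * φ x - ∑ y, c x y * φ y)) (o : ι) :
    ∃ u : ι → ℝ, (∀ x, 0 ≤ u x) ∧ u o = 1 ∧ ∀ x, ∑ y, c x y * u y ≤ D x * u x := by
  classical
  let T : (ι → ℝ) →ₗ[ℝ] (ι → ℝ) :=
    { toFun := fun φ x => D x * φ x - ∑ y, c x y * φ y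
      map_add' := fun φ ψ => by
        ext x
        simp only [Pi.add_apply, mul_add, Finset.sum_add_distrib]
        ring
      map_smul' := fun r φ => by
        ext x
        simp only [Pi.smul_apply, smul_eq_mul, RingHom.id_apply, mul_sub, Finset.mul_sum]
        congr 1
        · ring
        · exact Finset.sum_congr rfl fun y _ => by ring }
  have hT : ∀ φ x, T φ x = D x * φ x - ∑ y, c x y * φ y := fun _ _ => rfl
  have hinj : Function.Injective T := by
    refine (injective_iff_map_eq_zero T).2 fun φ hφ => ?_
    by_contra hne
    have h1 := hpd φ hne
    simp only [← hT, hφ] at h1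
    simp at h1
  obtain ⟨u, hu⟩ := LinearMap.injective_iff_surjective.1 hinj (Pi.single o 1)
  have hux : ∀ x, D x * u x - ∑ y, c x y * u y = (Pi.single o 1 : ι → ℝ) x := fun x => by
    rw [← hT, hu]
  have hδ : ∀ x, 0 ≤ (Pi.single o 1 : ι → ℝ) x := fun x => by
    by_cases h : x = o
    · subst h; simp
    · simp [h]
  have hneg : (fun x => max (-u x) 0) = 0 := by
    by_contra hne
    refine (hpd _ hne).not_ge (Finset.sum_nonpos fun x _ => ?_)
    rcases le_total (-u x) 0 with h | h
    · simp [max_eq_right h]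
    · have h1 : -∑ y, c x y * u y ≤ ∑ y, c x y * max (-u y) 0 := by
        rw [← Finset.sum_neg_distrib]
        refine Finset.sum_le_sum fun y _ => ?_
        rw [← mul_neg]
        exact mul_le_mul_of_nonneg_left (le_max_left _ _) (hc x y)
      have h2 := hux x
      have h3 := hδ x
      simp only [max_eq_left h]
      exact mul_nonpos_of_nonneg_of_nonpos h (by linarith)
  have hu0 : ∀ x, 0 ≤ u x := fun x => by
    have h1 : max (-u x) 0 = 0 := congrFun hneg x
    linarith [max_eq_right_iff.1 h1]
  have huo : 0 < u o := by
    have hne : u ≠ 0 := by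
      rintro rfl
      have h1 := hux o
      simp at h1
    have h1 := hpd u hne
    simp only [hux] at h1
    simpa [Pi.single_apply] using h1
  refine ⟨fun x => u x / u o, fun x => div_nonneg (hu0 x) huo.le, div_self huo.ne', fun x => ?_⟩
  simp only [← mul_div_assoc, ← Finset.sum_div]
  have h2 := hux x
  have h3 := hδ x
  exact div_le_div_of_nonneg_right (by linarith) huo.le

/-- Approximate supersolutions, normalized at a vertex, have a limit that is a supersolution. -/
theorem exists_supersolution_of_eventually {X I : Type*} {b : X → X → ℝ} {D : X → ℝ}
    (hb : ∀ x y, 0 ≤ b x y) (hconn : GraphConnected b) {l : Filter I} [l.NeBot]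
    {ε : I → ℝ} (hε : Tendsto ε l (𝓝 0)) {u : I → X → ℝ} {o : X}
    (hu0 : ∀ᶠ i in l, ∀ x, 0 ≤ u i x) (huo : ∀ᶠ i in l, u i o = 1)
    (hu : ∀ x (F : Finset X), ∀ᶠ i in l, ∑ y ∈ F, b x y * u i y ≤ (D x + ε i) * u i x) :
    ∃ v : X → ℝ, (∀ x, 0 ≤ v x) ∧ v o = 1 ∧
      ∀ x, (Summable fun y => b x y * v y) ∧ ∑' y, b x y * v y ≤ D x * v x := by
  have hbdd : ∀ x, ∃ C, ∀ᶠ i in l, u i x ≤ C := by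
    refine hconn.induction (P := fun x => ∃ C, ∀ᶠ i in l, u i x ≤ C) ?_
      (x := o) ⟨1, huo.mono fun i hi => hi.le⟩
    rintro x y hxy ⟨C, hC⟩
    refine ⟨(|D x| + 1) * C / b x y, ?_⟩
    filter_upwards [hC, hu x {y}, hu0, hε.eventually (eventually_le_nhds one_pos)]
      with i h1 h2 h3 h4
    rw [le_div_iff₀ hxy]
    rw [Finset.sum_singleton] at h2
    have h5 : (D x + ε i) * u i x ≤ (|D x| + 1) * u i x :=
      mul_le_mul_of_nonneg_right (add_le_add (le_abs_self _) h4) (h3 x)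
    have h6 : (|D x| + 1) * u i x ≤ (|D x| + 1) * C :=
      mul_le_mul_of_nonneg_left h1 (by positivity)
    linarith
  let U : Ultrafilter I := Ultrafilter.of l
  have hUl : (U : Filter I) ≤ l := Ultrafilter.of_le l
  have hlim : ∀ x, ∃ a, Tendsto (fun i => u i x) U (𝓝 a) := by
    intro x
    obtain ⟨C, hC⟩ := hbdd x
    have hmem : ∀ᶠ i in (U : Filter I), u i x ∈ Set.Icc 0 C := by
      filter_upwards [hUl hC, hUl hu0] with i h1 h2
      exact ⟨h2 x, h1⟩
    obtain ⟨a, -, ha⟩ := isCompact_Icc.ultrafilter_le_nhds (U.map fun i => u i x)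
      (le_principal_iff.2 hmem)
    exact ⟨a, ha⟩
  choose v hv using hlim
  have hv0 : ∀ x, 0 ≤ v x := fun x =>
    ge_of_tendsto (hv x) ((hu0.filter_mono hUl).mono fun i hi => hi x)
  have hF : ∀ x (F : Finset X), ∑ y ∈ F, b x y * v y ≤ D x * v x := by
    intro x F
    have h1 : Tendsto (fun i => ∑ y ∈ F, b x y * u i y) U (𝓝 (∑ y ∈ F, b x y * v y)) :=
      tendsto_finsetSum _ fun y _ => (hv y).const_mul _
    have h2 : Tendsto (fun i => (D x + ε i) * u i x) U (𝓝 ((D x + 0) * v x)) :=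
      ((hε.mono_left hUl).const_add _).mul (hv x)
    rw [add_zero] at h2
    exact le_of_tendsto_of_tendsto h1 h2 ((hu x F).filter_mono hUl)
  refine ⟨v, hv0, tendsto_nhds_unique (hv o) (tendsto_const_nhds.congr'
    ((huo.filter_mono hUl).mono fun i hi => hi.symm)), fun x => ?_⟩
  have hnn : ∀ y, 0 ≤ b x y * v y := fun y => mul_nonneg (hb x y) (hv0 y)
  exact ⟨summable_of_sum_le hnn (hF x), Real.tsum_le_of_sum_le hnn (hF x)⟩

theorem exists_supersolution_of_mul_sum_sq_le_hform {X : Type*} {b : X → X → ℝ} {q : X → ℝ}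
    [Nonempty X] (hb : IsGraph b) (hconn : GraphConnected b) {lam : ℝ}
    (hlam : ∀ (K : Finset X) (φ : X → ℝ), (∀ x ∉ K, φ x = 0) →
      lam * ∑ x ∈ K, φ x ^ 2 ≤ hform b q φ) :
    ∃ u : X → ℝ, MemF b u ∧ (∀ x, 0 ≤ u x) ∧ u ≠ 0 ∧ ∀ x, lam * u x ≤ Hop b q u x := by
  classical
  obtain ⟨o⟩ := ‹Nonempty X›
  let D : X → ℝ := fun x => (∑' y, b x y) + q x - lam
  have hfin : ∀ (K : Finset X) (ε : ℝ), o ∈ K → 0 < ε → ∃ u : X → ℝ, (∀ x, 0 ≤ u x) ∧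
      u o = 1 ∧ ∀ x ∈ K, ∑ y ∈ K, b x y * u y ≤ (D x + ε) * u x := by
    intro K ε ho hε
    obtain ⟨u, hu0, huo, hu⟩ := exists_nonneg_supersolution_of_posDef (ι := K)
      (c := fun x y => b x y) (D := fun x => D x + ε) (fun x y => hb.1 x y) (by
        intro φ hφ
        let ψ : X → ℝ := fun x => if h : x ∈ K then φ ⟨x, h⟩ else 0
        have hψ : ∀ x : K, φ x = ψ x := fun x => by simp [ψ]
        have h1 := hlam K ψ fun x hx => by simp [ψ, hx]
        rw [hform_eq_finset_sum q hb K ψ fun x hx => by simp [ψ, hx]] at h1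
        have h2 : 0 < ∑ x ∈ K, ψ x ^ 2 := by
          obtain ⟨x, hx⟩ := Function.ne_iff.1 hφ
          refine Finset.sum_pos' (fun y _ => sq_nonneg _) ⟨x, x.2, ?_⟩
          rw [← hψ]
          exact (sq_pos_iff.2 hx)
        simp only [hψ]
        have h3 : ∀ x, ∑ y : K, b x y * ψ y = ∑ y ∈ K, b x y * ψ y := fun x =>
          Finset.sum_coe_sort K fun y => b x y * ψ y
        simp only [h3]
        rw [Finset.sum_coe_sort K fun x => ψ x * ((D x + ε) * ψ x - ∑ y ∈ K, b x y * ψ y)]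
        have h4 : ∑ x ∈ K, ψ x * ((D x + ε) * ψ x - ∑ y ∈ K, b x y * ψ y) =
            ∑ x ∈ K, ((∑' y, b x y) + q x) * ψ x ^ 2
              - ∑ x ∈ K, ∑ y ∈ K, b x y * (ψ x * ψ y)
              - lam * ∑ x ∈ K, ψ x ^ 2 + ε * ∑ x ∈ K, ψ x ^ 2 := by
          rw [Finset.mul_sum, Finset.mul_sum, ← Finset.sum_sub_distrib,
            ← Finset.sum_sub_distrib, ← Finset.sum_add_distrib]
          refine Finset.sum_congr rfl fun x _ => ?_
          have h5 : ∑ y ∈ K, b x y * (ψ x * ψ y) = ψ x * ∑ y ∈ K, b x y * ψ y := by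
            rw [Finset.mul_sum]
            exact Finset.sum_congr rfl fun y _ => by ring
          rw [h5]
          ring
        rw [h4]
        have := mul_pos hε h2
        linarith) ⟨o, ho⟩
    refine ⟨fun x => if h : x ∈ K then u ⟨x, h⟩ else 0, fun x => ?_, by simpa [ho] using huo,
      fun x hx => ?_⟩
    · dsimp only
      split_ifs
      exacts [hu0 _, le_rfl]
    · have h1 := hu ⟨x, hx⟩
      rw [← Finset.sum_coe_sort]
      simpa [hx] using h1
  choose! w hw0 hwo hw using hfin
  obtain ⟨v, hv0, hvo, hv⟩ := exists_supersolution_of_eventually (I := Finset X × ℕ) (D := D)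
    hb.1 hconn (l := atTop ×ˢ atTop) (ε := fun i => 1 / ((i.2 : ℝ) + 1))
    (u := fun i => w i.1 (1 / ((i.2 : ℝ) + 1))) (o := o)
    (tendsto_one_div_add_atTop_nhds_zero_nat.comp tendsto_snd)
    (by
      filter_upwards [tendsto_fst.eventually (eventually_ge_atTop {o})] with i hi
      exact hw0 _ _ (hi (Finset.mem_singleton_self o)) (by positivity))
    (by
      filter_upwards [tendsto_fst.eventually (eventually_ge_atTop {o})] with i hi
      exact hwo _ _ (hi (Finset.mem_singleton_self o)) (by positivity))
    (by
      intro x F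
      filter_upwards [tendsto_fst.eventually (eventually_ge_atTop (insert o (insert x F)))]
        with i hi
      have ho : o ∈ i.1 := hi (by simp)
      have hε : (0 : ℝ) < 1 / ((i.2 : ℝ) + 1) := by positivity
      refine le_trans ?_ (hw i.1 _ ho hε x (hi (by simp)))
      refine Finset.sum_le_sum_of_subset_of_nonneg (fun y hy => hi (by simp [hy])) ?_
      exact fun y _ _ => mul_nonneg (hb.1 x y) (hw0 _ _ ho hε y))
  refine ⟨v, fun x => ?_, hv0, fun h => ?_, fun x => ?_⟩
  · simpa only [abs_of_nonneg (hv0 _)] using (hv x).1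
  · simp [h] at hvo
  · rw [hop_eq_sub_tsum q (hb.2.2.2 x) (hv x).1]
    have h1 := (hv x).2
    simp only [D, sub_mul] at h1
    linarith

theorem hform_const_mul {X : Type*} (b : X → X → ℝ) (q : X → ℝ) (c : ℝ) (φ : X → ℝ) :
    hform b q (fun x => c * φ x) = c ^ 2 * hform b q φ := by
  have h1 : ∑' p : X × X, b p.1 p.2 * (c * φ p.1 - c * φ p.2) ^ 2 =
      c ^ 2 * ∑' p : X × X, b p.1 p.2 * (φ p.1 - φ p.2) ^ 2 := by
    rw [← tsum_mul_left]
    exact tsum_congr fun p => by ring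
  have h2 : ∑' x, q x * (c * φ x) ^ 2 = c ^ 2 * ∑' x, q x * φ x ^ 2 := by
    rw [← tsum_mul_left]
    exact tsum_congr fun p => by ring
  rw [hform, hform, h1, h2]
  ring

end AllegrettoPiepenbrink

/-- Allegretto–Piepenbrink theorem, measure-free version. -/
theorem allegretto_piepenbrink_measure_free (b : X → X → ℝ) (q : X → ℝ)
    (hX : Infinite X) (hb : IsGraph b) (hconn : GraphConnected b)
    (hpos : ∀ φ : X → ℝ, FinSupp φ → 0 ≤ hform b q φ) :
    IsGreatest {lam : ℝ | ∃ u : X → ℝ, MemF b u ∧ (∀ x, 0 ≤ u x) ∧ u ≠ 0 ∧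
        ∀ x, lam * u x ≤ Hop b q u x}
      (sInf {r : ℝ | ∃ φ : X → ℝ, FinSupp φ ∧ (∑' x, φ x ^ 2) = 1 ∧ r = hform b q φ}) := by
  have hfs : ∀ (K : Finset X) (φ : X → ℝ), (∀ x ∉ K, φ x = 0) → FinSupp φ :=
    fun K φ hφ => K.finite_toSet.subset fun x hx => by
      by_contra hxK
      exact hx (hφ x hxK)
  have hts : ∀ (K : Finset X) (φ : X → ℝ), (∀ x ∉ K, φ x = 0) →
      ∑' x, φ x ^ 2 = ∑ x ∈ K, φ x ^ 2 :=
    fun K φ hφ => tsum_eq_sum fun x hx => by simp [hφ x hx]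
  have hbdd : BddBelow {r : ℝ | ∃ φ : X → ℝ, FinSupp φ ∧ (∑' x, φ x ^ 2) = 1 ∧
      r = hform b q φ} := by
    refine ⟨0, ?_⟩
    rintro r ⟨φ, hφ, -, rfl⟩
    exact hpos φ hφ
  constructor
  · refine exists_supersolution_of_mul_sum_sq_le_hform hb hconn fun K φ hφ => ?_
    have hs0 : 0 ≤ ∑ x ∈ K, φ x ^ 2 := Finset.sum_nonneg fun x _ => sq_nonneg _
    rcases hs0.eq_or_lt with hs | hs
    · rw [← hs, mul_zero]
      exact hpos φ (hfs K φ hφ)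
    · have hc : ((√(∑ x ∈ K, φ x ^ 2))⁻¹) ^ 2 = (∑ x ∈ K, φ x ^ 2)⁻¹ := by
        rw [inv_pow, Real.sq_sqrt hs0]
      have hψ : ∀ x ∉ K, (√(∑ x ∈ K, φ x ^ 2))⁻¹ * φ x = 0 := fun x hx => by simp [hφ x hx]
      have h1 := csInf_le hbdd ⟨_, hfs K _ hψ, by
        rw [hts K _ hψ]
        simp only [mul_pow]
        rw [← Finset.mul_sum, hc, inv_mul_cancel₀ hs.ne'], rfl⟩
      rw [hform_const_mul, hc, ← div_eq_inv_mul, le_div_iff₀ hs] at h1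
      exact h1
  · rintro lam ⟨u, huF, hu0, hune, hu⟩
    refine le_csInf ?_ ?_
    · classical
      obtain ⟨o⟩ : Nonempty X := inferInstance
      have ho : ∀ x ∉ ({o} : Finset X), (Pi.single o 1 : X → ℝ) x = 0 := fun x hx => by
        rw [Finset.mem_singleton] at hx
        exact Pi.single_eq_of_ne hx 1
      exact ⟨_, Pi.single o 1, hfs {o} _ ho, by simp [hts {o} _ ho], rfl⟩
    · rintro r ⟨φ, hφ, hnorm, rfl⟩
      have hφ' : (Function.support φ).Finite := hφ
      have hK : ∀ x ∉ hφ'.toFinset, φ x = 0 := fun x hx => by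
        rwa [Set.Finite.mem_toFinset, Function.notMem_support] at hx
      have h1 := mul_sum_sq_le_hform_of_supersolution hb hconn huF hu0 hune hu _ φ hK
      rwa [← hts _ φ hK, hnorm, mul_one] at h1
end

section
/- Invertibility of the restricted operator: Let b be a connected graph over the infinite set X and q : X → ℝ a potential such that h ≥ 0, and let K ⊆ X be a finite subset. If u : X → ℝ is supported in K and satisfies Hu(x) = 0 for all x ∈ K, then u = 0. Consequently, for every function g : K → ℝ there is a unique u supported in K with Hu(x) = g(x) for all x ∈ K. -/
open Filter Topology

variable {X : Type*}

/-- The operator `H` on functions supported in a finite set. -/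
lemma Hop_eq_of_support_subset {b : X → X → ℝ} (hb : IsGraph b) (q : X → ℝ) (F : Finset X)
    {φ : X → ℝ} (hφ : ∀ x, φ x ≠ 0 → x ∈ F) (x : X) :
    Hop b q φ x = ((∑' y, b x y) + q x) * φ x - ∑ y ∈ F, b x y * φ y := by
  obtain ⟨-, -, -, hsum⟩ := hb
  have hF : HasSum (fun y => b x y * φ y) (∑ y ∈ F, b x y * φ y) :=
    hasSum_sum_of_ne_finset_zero fun y hy => by
      rw [not_imp_comm.1 (hφ y) hy, mul_zero]
  have h := (((hsum x).hasSum.mul_right (φ x)).sub hF).tsum_eq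
  unfold Hop
  simp only [mul_sub]
  rw [h]
  ring

/-- The energy form on functions supported in a finite set. -/
lemma hform_eq_of_support_subset {b : X → X → ℝ} (hb : IsGraph b) (q : X → ℝ) (F : Finset X)
    {φ : X → ℝ} (hφ : ∀ x, φ x ≠ 0 → x ∈ F) :
    hform b q φ = ∑ x ∈ F, ((∑' y, b x y) + q x) * φ x ^ 2 -
      ∑ x ∈ F, ∑ y ∈ F, b x y * φ x * φ y := by
  obtain ⟨hnn, hsymm, -, hsum⟩ := hb
  have hzero : ∀ x, x ∉ F → φ x = 0 := fun x hx => not_imp_comm.1 (hφ x) hx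
  have hrow : ∀ x, HasSum (fun y => b x y * φ x ^ 2) ((∑' y, b x y) * φ x ^ 2) := fun x =>
    (hsum x).hasSum.mul_right _
  have hcol : HasSum (fun x => (∑' y, b x y) * φ x ^ 2) (∑ x ∈ F, (∑' y, b x y) * φ x ^ 2) :=
    hasSum_sum_of_ne_finset_zero fun x hx => by simp [hzero x hx]
  have hsummable : Summable fun p : X × X => b p.1 p.2 * φ p.1 ^ 2 := by
    rw [summable_prod_of_nonneg fun p => mul_nonneg (hnn _ _) (sq_nonneg _)]
    refine ⟨fun x => (hrow x).summable, ?_⟩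
    simp only [(hrow _).tsum_eq]
    exact hcol.summable
  have hfst : HasSum (fun p : X × X => b p.1 p.2 * φ p.1 ^ 2)
      (∑ x ∈ F, (∑' y, b x y) * φ x ^ 2) := by
    have h := hsummable.hasSum
    rwa [(h.prod_fiberwise hrow).unique hcol] at h
  have hsnd : HasSum (fun p : X × X => b p.1 p.2 * φ p.2 ^ 2)
      (∑ x ∈ F, (∑' y, b x y) * φ x ^ 2) := by
    refine ((Equiv.prodComm X X).hasSum_iff.2 hfst).congr_fun ?_
    intro p
    simp [hsymm p.1 p.2]
  have hcross : HasSum (fun p : X × X => b p.1 p.2 * φ p.1 * φ p.2)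
      (∑ x ∈ F, ∑ y ∈ F, b x y * φ x * φ y) := by
    rw [← Finset.sum_product' F F fun x y => b x y * φ x * φ y]
    refine hasSum_sum_of_ne_finset_zero fun p hp => ?_
    rw [Finset.mem_product, not_and_or] at hp
    rcases hp with hp | hp <;> simp [hzero _ hp]
  have hq : ∑' x, q x * φ x ^ 2 = ∑ x ∈ F, q x * φ x ^ 2 :=
    tsum_eq_sum fun x hx => by simp [hzero x hx]
  have hpair : ∑' p : X × X, b p.1 p.2 * (φ p.1 - φ p.2) ^ 2 =
      ∑ x ∈ F, (∑' y, b x y) * φ x ^ 2 + ∑ x ∈ F, (∑' y, b x y) * φ x ^ 2 -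
        2 * ∑ x ∈ F, ∑ y ∈ F, b x y * φ x * φ y := by
    rw [← ((hfst.add hsnd).sub (hcross.mul_left 2)).tsum_eq]
    exact tsum_congr fun p => by ring
  unfold hform
  rw [hpair, hq]
  simp only [add_mul, Finset.sum_add_distrib]
  ring

/-- Green's formula for finitely supported functions. -/
lemma hform_eq_sum_mul_Hop {b : X → X → ℝ} (hb : IsGraph b) (q : X → ℝ) (F : Finset X)
    {φ : X → ℝ} (hφ : ∀ x, φ x ≠ 0 → x ∈ F) :
    hform b q φ = ∑ x ∈ F, φ x * Hop b q φ x := by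
  rw [hform_eq_of_support_subset hb q F hφ, ← Finset.sum_sub_distrib]
  refine Finset.sum_congr rfl fun x _ => ?_
  rw [Hop_eq_of_support_subset hb q F hφ, mul_sub, Finset.mul_sum]
  congr 1
  · ring
  · exact Finset.sum_congr rfl fun y _ => by ring

lemma hform_abs_le {b : X → X → ℝ} (hb : IsGraph b) (q : X → ℝ) (F : Finset X)
    {φ : X → ℝ} (hφ : ∀ x, φ x ≠ 0 → x ∈ F) :
    hform b q (fun x => |φ x|) ≤ hform b q φ := by
  rw [hform_eq_of_support_subset hb q F hφ,
    hform_eq_of_support_subset hb q F fun x hx => hφ x (abs_ne_zero.1 hx)]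
  simp only [sq_abs]
  refine sub_le_sub_left (Finset.sum_le_sum fun x _ => Finset.sum_le_sum fun y _ => ?_) _
  rw [mul_assoc, mul_assoc, ← abs_mul]
  exact mul_le_mul_of_nonneg_left (le_abs_self _) (hb.1 x y)

/-- A nonnegative function of nonpositive energy vanishing at a vertex vanishes at all of its
neighbours. -/
lemma eq_zero_of_adj_of_hform_nonpos {b : X → X → ℝ} (hb : IsGraph b) {q : X → ℝ}
    (hpos : ∀ φ : X → ℝ, FinSupp φ → 0 ≤ hform b q φ) {v : X → ℝ} (hv : FinSupp v)
    (hv_nonneg : ∀ x, 0 ≤ v x) (henergy : hform b q v ≤ 0) {x y : X} (hx : v x = 0)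
    (hxy : 0 < b x y) : v y = 0 := by
  classical
  obtain ⟨F, hF⟩ : ∃ F : Finset X, ∀ z, z ∈ F ↔ v z ≠ 0 :=
    ⟨Set.Finite.toFinset hv, fun _ => Set.Finite.mem_toFinset hv⟩
  have hvF : ∀ z, v z ≠ 0 → z ∈ F := fun z => (hF z).2
  have hxF : x ∉ F := fun h => (hF x).1 h hx
  have hne : ∀ z ∈ F, z ≠ x := fun z hz h => hxF (h ▸ hz)
  set S := ∑ z ∈ F, b x z * v z with hS
  set c := (∑' z, b x z) + q x
  have key : ∀ t : ℝ, 0 ≤ c * t ^ 2 - 2 * t * S := by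
    intro t
    have hsupp : ∀ z, Function.update v x t z ≠ 0 → z ∈ insert x F := by
      intro z hz
      by_cases h : z = x
      · simp [h]
      · rw [Function.update_of_ne h] at hz
        exact Finset.mem_insert_of_mem (hvF z hz)
    have hfin : FinSupp (Function.update v x t) :=
      (insert x F).finite_toSet.subset fun z hz => hsupp z hz
    have h := hpos _ hfin
    have h1 : ∑ z ∈ F, ((∑' w, b z w) + q z) * Function.update v x t z ^ 2 =
        ∑ z ∈ F, ((∑' w, b z w) + q z) * v z ^ 2 :=
      Finset.sum_congr rfl fun z hz => by rw [Function.update_of_ne (hne z hz)]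
    have h2 : ∑ z ∈ F, b x z * t * Function.update v x t z = t * S := by
      rw [hS, Finset.mul_sum]
      exact Finset.sum_congr rfl fun z hz => by rw [Function.update_of_ne (hne z hz)]; ring
    have h3 : ∑ z ∈ F, b z x * Function.update v x t z * t = t * S := by
      rw [hS, Finset.mul_sum]
      exact Finset.sum_congr rfl fun z hz => by
        rw [Function.update_of_ne (hne z hz), hb.2.1 z x]; ring
    have h4 : ∑ z ∈ F, ∑ w ∈ F, b z w * Function.update v x t z * Function.update v x t w =
        ∑ z ∈ F, ∑ w ∈ F, b z w * v z * v w :=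
      Finset.sum_congr rfl fun z hz => Finset.sum_congr rfl fun w hw => by
        rw [Function.update_of_ne (hne z hz), Function.update_of_ne (hne w hw)]
    rw [hform_eq_of_support_subset hb q _ hsupp] at h
    simp only [Finset.sum_insert hxF, Finset.sum_add_distrib, Function.update_self, h1, h2, h3,
      h4, hb.2.2.1 x] at h
    rw [hform_eq_of_support_subset hb q F hvF] at henergy
    linarith
  have hterm : ∀ z ∈ F, 0 ≤ b x z * v z := fun z _ => mul_nonneg (hb.1 x z) (hv_nonneg z)
  have hSzero : S = 0 := by
    have hd : discrim c (-(2 * S)) 0 ≤ 0 := discrim_le_zero fun t => by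
      have := key t
      linarith
    unfold discrim at hd
    nlinarith [sq_nonneg S]
  by_contra hy
  have := (Finset.sum_eq_zero_iff_of_nonneg hterm).1 hSzero y (hvF y hy)
  exact (mul_ne_zero hxy.ne' hy) this

/-- The Dirichlet problem with zero data on a finite set has only the trivial solution. -/
lemma eq_zero_of_Hop_eq_zero_on_finset {b : X → X → ℝ} {q : X → ℝ} [Infinite X]
    (hb : IsGraph b) (hconn : GraphConnected b)
    (hpos : ∀ φ : X → ℝ, FinSupp φ → 0 ≤ hform b q φ) (F : Finset X) {u : X → ℝ}
    (hu : ∀ x, u x ≠ 0 → x ∈ F) (hHu : ∀ x ∈ F, Hop b q u x = 0) : u = 0 := by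
  have henergy : hform b q (fun x => |u x|) ≤ 0 := by
    refine (hform_abs_le hb q F hu).trans_eq ?_
    rw [hform_eq_sum_mul_Hop hb q F hu]
    exact Finset.sum_eq_zero fun x hx => by rw [hHu x hx, mul_zero]
  have hfin : FinSupp fun x => |u x| :=
    F.finite_toSet.subset fun x hx => hu x (abs_ne_zero.1 hx)
  obtain ⟨o, ho⟩ := Infinite.exists_notMem_finset F
  funext x
  obtain ⟨n, p, hp0, hpn, hp⟩ := hconn o x
  have hpath : ∀ i ≤ n, |u (p i)| = 0 := by
    intro i
    induction i with
    | zero => intro _; rw [hp0, not_imp_comm.1 (hu o) ho, abs_zero]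
    | succ i ih =>
      intro hi
      exact eq_zero_of_adj_of_hform_nonpos hb hpos hfin (fun _ => abs_nonneg _) henergy
        (ih (by omega)) (hp i hi)
  simpa [hpn] using hpath n le_rfl

/-- Invertibility of the operator restricted to a finite set. -/
theorem restricted_operator_invertible (b : X → X → ℝ) (q : X → ℝ)
    (hX : Infinite X) (hb : IsGraph b) (hconn : GraphConnected b)
    (hpos : ∀ φ : X → ℝ, FinSupp φ → 0 ≤ hform b q φ)
    (K : Set X) (hK : K.Finite) :
    (∀ u : X → ℝ, (∀ x, u x ≠ 0 → x ∈ K) → (∀ x ∈ K, Hop b q u x = 0) → u = 0) ∧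
    ∀ g : X → ℝ, ∃! u : X → ℝ, (∀ x, u x ≠ 0 → x ∈ K) ∧ ∀ x ∈ K, Hop b q u x = g x := by
  classical
  have hKF : ∀ x, x ∈ hK.toFinset ↔ x ∈ K := fun x => hK.mem_toFinset
  have hHop : ∀ u : X → ℝ, (∀ x, u x ≠ 0 → x ∈ K) → ∀ x, Hop b q u x =
      ((∑' y, b x y) + q x) * u x - ∑ y ∈ hK.toFinset, b x y * u y := fun u hu =>
    Hop_eq_of_support_subset hb q _ fun x hx => (hKF x).2 (hu x hx)
  have hinj : ∀ u : X → ℝ, (∀ x, u x ≠ 0 → x ∈ K) → (∀ x ∈ K, Hop b q u x = 0) → u = 0 :=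
    fun u hu hHu => eq_zero_of_Hop_eq_zero_on_finset hb hconn hpos hK.toFinset
      (fun x hx => (hKF x).2 (hu x hx)) fun x hx => hHu x ((hKF x).1 hx)
  refine ⟨hinj, fun g => ?_⟩
  have : Finite K := hK
  let E : (K → ℝ) → X → ℝ := fun f x => if h : x ∈ K then f ⟨x, h⟩ else 0
  have hE : ∀ f x, E f x ≠ 0 → x ∈ K := fun f x hx => by
    by_contra h
    exact hx (dif_neg h)
  have hE_coe : ∀ f (k : K), E f k = f k := fun f k => dif_pos k.2
  have hE_add : ∀ f f' x, E (f + f') x = E f x + E f' x := fun f f' x => by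
    by_cases h : x ∈ K <;> simp [E, h]
  have hE_smul : ∀ (c : ℝ) f x, E (c • f) x = c * E f x := fun c f x => by
    by_cases h : x ∈ K <;> simp [E, h]
  let T : (K → ℝ) →ₗ[ℝ] (K → ℝ) :=
    { toFun := fun f k => Hop b q (E f) k
      map_add' := fun f f' => by
        funext k
        simp only [Pi.add_apply, hHop _ (hE _), hE_add, mul_add, Finset.sum_add_distrib]
        ring
      map_smul' := fun c f => by
        funext k
        simp only [Pi.smul_apply, smul_eq_mul, RingHom.id_apply, hHop _ (hE _), hE_smul,
          mul_sub, Finset.mul_sum]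
        congr 1
        · ring
        · exact Finset.sum_congr rfl fun y _ => by ring }
  have hT : Function.Injective T := by
    refine (injective_iff_map_eq_zero T).2 fun f hf => ?_
    have hEf := hinj (E f) (hE f) fun x hx => congr_fun hf ⟨x, hx⟩
    funext k
    rw [← hE_coe f k, hEf]
    rfl
  obtain ⟨f, hf⟩ := LinearMap.injective_iff_surjective.1 hT fun k => g k
  have hfg : ∀ x ∈ K, Hop b q (E f) x = g x := fun x hx => congr_fun hf ⟨x, hx⟩
  refine ⟨E f, ⟨hE f, hfg⟩, ?_⟩
  rintro u ⟨hu, hug⟩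
  have hsupp : ∀ x, (u - E f) x ≠ 0 → x ∈ K := fun x hx => by
    by_contra h
    exact hx (by simp [not_imp_comm.1 (hu x) h, not_imp_comm.1 (hE f x) h])
  refine sub_eq_zero.1 (hinj _ hsupp fun x hx => ?_)
  have h₁ := hug x hx
  have h₂ := hfg x hx
  rw [hHop _ hu] at h₁
  rw [hHop _ (hE f)] at h₂
  rw [hHop _ hsupp]
  simp only [Pi.sub_apply, mul_sub, Finset.sum_sub_distrib]
  linarith
end
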